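/- arXiv:1902.07665 — 2 statements merged into one kernel-verified Lean document; each statement's English description precedes it below -/
import Mathlib

section
/- Let q, s be distinct coprime integers. Then there is a constant C depending only on q and s such that for every finite nonempty subset A of ℝ, |q·A + s·A| ≥ (|q| + |s|)|A| − C. -/
open Pointwise

namespace Dil

/-- the set `p·X + q·Y`. -/
def S (p q : ℤ) (X Y : Finset ℤ) : Finset ℤ :=
  (X ×ˢ Y).image fun z => p * z.1 + q * z.2

lemma mem_S {p q : ℤ} {X Y : Finset ℤ} {n : ℤ} :
    n ∈ S p q X Y ↔ ∃ x ∈ X, ∃ y ∈ Y, p * x + q * y = n := by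
  simp only [S, Finset.mem_image, Finset.mem_product, Prod.exists]
  constructor
  · rintro ⟨x, y, ⟨hx, hy⟩, h⟩; exact ⟨x, hx, y, hy, h⟩
  · rintro ⟨x, hx, y, hy, h⟩; exact ⟨x, y, ⟨hx, hy⟩, h⟩

lemma S_comm (p q : ℤ) (X Y : Finset ℤ) : S p q X Y = S q p Y X := by
  ext n
  simp only [mem_S]
  constructor
  · rintro ⟨x, hx, y, hy, h⟩; exact ⟨y, hy, x, hx, by linarith⟩
  · rintro ⟨x, hx, y, hy, h⟩; exact ⟨y, hy, x, hx, by linarith⟩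

/-- `A` meets every class mod `n`. -/
def FD (n : ℤ) (A : Finset ℤ) : Prop := ∀ r : ℤ, ∃ a ∈ A, n ∣ a - r

def Red (A : Finset ℤ) : Prop :=
  ∀ H : AddSubgroup ℤ, (∀ a ∈ A, ∀ b ∈ A, a - b ∈ H) → H = ⊤

/-- affine image -/
def af (c g : ℤ) (A : Finset ℤ) : Finset ℤ := A.image fun x => c + g * x

lemma mem_af {c g : ℤ} {A : Finset ℤ} {n : ℤ} : n ∈ af c g A ↔ ∃ x ∈ A, c + g * x = n := by
  simp [af]

lemma card_af (c : ℤ) {g : ℤ} (hg : g ≠ 0) (A : Finset ℤ) : (af c g A).card = A.card := by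
  apply Finset.card_image_of_injective
  intro x y h
  simpa [hg] using h

lemma S_af (p q c g : ℤ) (A : Finset ℤ) :
    S p q (af c g A) (af c g A) = af ((p + q) * c) g (S p q A A) := by
  ext n
  simp only [mem_S, mem_af]
  constructor
  · rintro ⟨_, ⟨x, hx, rfl⟩, _, ⟨y, hy, rfl⟩, rfl⟩
    exact ⟨_, ⟨x, hx, y, hy, rfl⟩, by ring⟩
  · rintro ⟨_, ⟨x, hx, y, hy, rfl⟩, rfl⟩
    exact ⟨_, ⟨x, hx, rfl⟩, _, ⟨y, hy, rfl⟩, by ring⟩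

lemma S_af_left (p q c : ℤ) (X A : Finset ℤ) :
    S p q (af c q X) A = af (p * c) q (S p 1 X A) := by
  ext n
  simp only [mem_S, mem_af]
  constructor
  · rintro ⟨_, ⟨x, hx, rfl⟩, y, hy, rfl⟩
    exact ⟨_, ⟨x, hx, y, hy, rfl⟩, by ring⟩
  · rintro ⟨_, ⟨x, hx, y, hy, rfl⟩, rfl⟩
    exact ⟨_, ⟨x, hx, rfl⟩, y, hy, by ring⟩

lemma exists_red (A : Finset ℤ) (hA : 1 < A.card) :
    ∃ c g A', g ≠ 0 ∧ A = af c g A' ∧ Red A' := by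
  obtain ⟨a0, ha0, b0, hb0, hab⟩ := Finset.one_lt_card.mp hA
  obtain ⟨g, hg⟩ := Int.subgroup_cyclic
    (AddSubgroup.closure {d : ℤ | ∃ a ∈ A, ∃ b ∈ A, d = a - b})
  have hdvd : ∀ a ∈ A, ∀ b ∈ A, g ∣ a - b := by
    intro a ha b hb
    have : a - b ∈ AddSubgroup.closure {d : ℤ | ∃ a ∈ A, ∃ b ∈ A, d = a - b} :=
      AddSubgroup.subset_closure ⟨a, ha, b, hb, rfl⟩
    rw [hg, ← AddSubgroup.zmultiples_eq_closure, Int.mem_zmultiples_iff] at this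
    exact this
  have hg0 : g ≠ 0 := by
    rintro rfl
    have := hdvd a0 ha0 b0 hb0
    rw [zero_dvd_iff] at this
    omega
  have hdiv : ∀ a ∈ A, g * ((a - a0) / g) = a - a0 := fun a ha =>
    Int.mul_ediv_cancel' (hdvd a ha a0 ha0)
  refine ⟨a0, g, A.image fun a => (a - a0) / g, hg0, ?_, ?_⟩
  · ext n
    simp only [mem_af, Finset.mem_image]
    constructor
    · intro hn
      exact ⟨_, ⟨n, hn, rfl⟩, by rw [hdiv n hn]; ring⟩
    · rintro ⟨_, ⟨a, ha, rfl⟩, rfl⟩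
      rw [hdiv a ha]; simpa using ha
  · intro H hH
    have h1 : AddSubgroup.closure {d : ℤ | ∃ a ∈ A, ∃ b ∈ A, d = a - b} ≤
        H.map (AddMonoidHom.mulLeft g) := by
      rw [AddSubgroup.closure_le]
      rintro _ ⟨a, ha, b, hb, rfl⟩
      refine ⟨_, hH _ (Finset.mem_image_of_mem _ ha) _ (Finset.mem_image_of_mem _ hb), ?_⟩
      simp only [AddMonoidHom.coe_mulLeft, mul_sub, hdiv a ha, hdiv b hb]
      ring
    have h2 : g ∈ H.map (AddMonoidHom.mulLeft g) := by
      apply h1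
      rw [hg]
      exact AddSubgroup.subset_closure rfl
    obtain ⟨h, hh, e⟩ := h2
    have e' : g * h = g * 1 := by simpa using e
    have : h = 1 := mul_left_cancel₀ hg0 e'
    subst this
    rw [eq_top_iff]
    intro n _
    simpa using H.zsmul_mem hh n

lemma FD_of_af {n c g : ℤ} {A : Finset ℤ} (h : FD n (af c g A)) : FD n A := by
  -- g is a unit mod n
  obtain ⟨a0, ha0, h0⟩ := h 0
  obtain ⟨a1, ha1, h1⟩ := h 1
  obtain ⟨x0, -, rfl⟩ := mem_af.mp ha0
  obtain ⟨x1, -, rfl⟩ := mem_af.mp ha1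
  have hcop : IsCoprime n g := by
    obtain ⟨k, hk⟩ := dvd_sub h1 h0
    exact ⟨-k, x1 - x0, by linear_combination hk⟩
  intro r
  obtain ⟨a, ha, hr⟩ := h (c + g * r)
  obtain ⟨x, hx, rfl⟩ := mem_af.mp ha
  refine ⟨x, hx, hcop.dvd_of_dvd_mul_left ?_⟩
  have e : g * (x - r) = c + g * x - (c + g * r) := by ring
  rw [e]; exact hr

lemma card_Ico_abs (n : ℤ) : ((Finset.Ico 0 |n|).card : ℝ) = |(n : ℝ)| := by
  have h : ((Finset.Ico 0 |n|).card : ℤ) = |n| := by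
    rw [Int.card_Ico, sub_zero, Int.toNat_of_nonneg (abs_nonneg n)]
  have h2 : (((Finset.Ico 0 |n|).card : ℤ) : ℝ) = ((|n| : ℤ) : ℝ) := by rw [h]
  rw [Int.cast_abs] at h2
  exact_mod_cast h2

/-- class of `X` -/
def cl (q i : ℤ) (X : Finset ℤ) : Finset ℤ := X.filter fun x => x % q = i

lemma mem_cl {q i x : ℤ} {X : Finset ℤ} : x ∈ cl q i X ↔ x ∈ X ∧ x % q = i := by
  simp [cl]

lemma emod_eq_iff {q x y : ℤ} : x % q = y % q ↔ q ∣ x - y := by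
  rw [Int.emod_eq_emod_iff_emod_sub_eq_zero, Int.dvd_iff_emod_eq_zero]

lemma card_eq_sum_cl {q : ℤ} (hq : q ≠ 0) (A : Finset ℤ) :
    A.card = ∑ i ∈ Finset.Ico 0 |q|, (cl q i A).card := by
  apply Finset.card_eq_sum_card_fiberwise
  intro x _
  simp only [Finset.coe_Ico, Set.mem_Ico]
  exact ⟨Int.emod_nonneg _ hq, Int.emod_lt_abs _ hq⟩

lemma S_mono {p q : ℤ} {X X' Y Y' : Finset ℤ} (h : X ⊆ X') (h' : Y ⊆ Y') :
    S p q X Y ⊆ S p q X' Y' := by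
  intro n hn
  obtain ⟨x, hx, y, hy, e⟩ := mem_S.mp hn
  exact mem_S.mpr ⟨x, h hx, y, h' hy, e⟩

/-- sums with first coordinates from different classes mod `q` are different. -/
lemma dvd_of_eq {p q x x' y y' : ℤ} (hco : IsCoprime p q)
    (h : p * x + q * y = p * x' + q * y') : q ∣ x - x' := by
  refine hco.symm.dvd_of_dvd_mul_left (z := x - x') ⟨y' - y, ?_⟩
  linear_combination h

lemma S_split {p q : ℤ} (hco : IsCoprime p q) (X Y : Finset ℤ) :
    ∑ i ∈ Finset.Ico 0 |q|, (S p q (cl q i X) Y).card ≤ (S p q X Y).card := by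
  rw [← Finset.card_biUnion]
  · apply Finset.card_le_card
    intro n hn
    simp only [Finset.mem_biUnion] at hn
    obtain ⟨i, -, hn⟩ := hn
    exact S_mono (Finset.filter_subset _ _) (subset_refl _) hn
  · intro i _ j _ hij
    rw [Function.onFun, Finset.disjoint_left]
    intro n hn hn'
    obtain ⟨x, hx, y, hy, e⟩ := mem_S.mp hn
    obtain ⟨x', hx', y', hy', e'⟩ := mem_S.mp hn'
    have := emod_eq_iff.mpr (dvd_of_eq hco (e.trans e'.symm))
    rw [(mem_cl.mp hx).2, (mem_cl.mp hx').2] at this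
    exact hij this

lemma cl_eq_af (q i : ℤ) (A : Finset ℤ) :
    ∃ X, cl q i A = af i q X := by
  refine ⟨(cl q i A).image fun x => (x - i) / q, ?_⟩
  have key : ∀ x ∈ cl q i A, i + q * ((x - i) / q) = x := by
    intro x hx
    have : q ∣ x - i := by
      rw [← (mem_cl.mp hx).2]; exact Int.dvd_self_sub_emod
    rw [Int.mul_ediv_cancel' this]; ring
  ext n
  simp only [mem_af, Finset.mem_image]
  constructor
  · intro hn; exact ⟨_, ⟨n, hn, rfl⟩, key n hn⟩
  · rintro ⟨_, ⟨a, ha, rfl⟩, rfl⟩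
    rw [key a ha]; exact ha

lemma piece_sum {p q : ℤ} (hq : q ≠ 0) (hco : IsCoprime p q) (A : Finset ℤ) (t C : ℝ)
    (h : ∀ i X, (∀ x ∈ X, i + q * x ∈ A) → t * X.card - C ≤ (S p 1 X A).card) :
    t * A.card - |(q : ℝ)| * C ≤ (S p q A A).card := by
  have h1 : ∀ i ∈ Finset.Ico 0 |q|,
      t * (cl q i A).card - C ≤ (S p q (cl q i A) A).card := by
    intro i _
    obtain ⟨X, hX⟩ := cl_eq_af q i A
    rw [hX, S_af_left, card_af _ hq, card_af _ hq]
    apply h i X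
    intro x hx
    have : i + q * x ∈ cl q i A := hX ▸ mem_af.mpr ⟨x, hx, rfl⟩
    exact (mem_cl.mp this).1
  have h2 := Finset.sum_le_sum h1
  have h3 : ((∑ i ∈ Finset.Ico 0 |q|, (S p q (cl q i A) A).card : ℕ) : ℝ) ≤ (S p q A A).card := by
    exact_mod_cast S_split hco A A
  have h4 : (A.card : ℝ) = ∑ i ∈ Finset.Ico 0 |q|, ((cl q i A).card : ℝ) := by
    exact_mod_cast card_eq_sum_cl hq A
  have h5 : ((Finset.Ico 0 |q|).card : ℝ) = |(q : ℝ)| := card_Ico_abs q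
  rw [Finset.sum_sub_distrib, ← Finset.mul_sum, ← h4, Finset.sum_const, nsmul_eq_mul, h5] at h2
  push_cast at h3
  linarith

lemma card_S_ge {p q : ℤ} (hp : p ≠ 0) (hq : q ≠ 0) {X Y : Finset ℤ} (hX : X.Nonempty)
    (hY : Y.Nonempty) : X.card + Y.card ≤ (S p q X Y).card + 1 := by
  have e : S p q X Y = af 0 p X + af 0 q Y := by
    ext n
    simp only [mem_S, Finset.mem_add, mem_af]
    constructor
    · rintro ⟨x, hx, y, hy, e⟩
      exact ⟨_, ⟨x, hx, rfl⟩, _, ⟨y, hy, rfl⟩, by linarith⟩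
    · rintro ⟨_, ⟨x, hx, rfl⟩, _, ⟨y, hy, rfl⟩, e⟩
      exact ⟨x, hx, y, hy, by linarith⟩
  have := cauchy_davenport_add_of_linearOrder_isCancelAdd (s := af 0 p X) (t := af 0 q Y)
    (hX.image _) (hY.image _)
  rw [card_af _ hp, card_af _ hq, ← e] at this
  omega

lemma cl_nonempty {q i : ℤ} (hi : i ∈ Finset.Ico 0 |q|) {A : Finset ℤ} (h : FD q A) :
    (cl q i A).Nonempty := by
  obtain ⟨a, ha, hr⟩ := h i
  refine ⟨a, mem_cl.mpr ⟨ha, ?_⟩⟩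
  rw [emod_eq_iff.mpr hr]
  rw [Finset.mem_Ico] at hi
  rw [← Int.emod_abs]
  exact Int.emod_eq_of_lt hi.1 hi.2

lemma FD_both {p q : ℤ} (hp : p ≠ 0) (hq : q ≠ 0) (hco : IsCoprime p q) {A : Finset ℤ}
    (h1 : FD p A) (h2 : FD q A) :
    (|(p : ℝ)| + |(q : ℝ)|) * A.card - |(p : ℝ)| * |(q : ℝ)| ≤ (S p q A A).card := by
  have c : ∀ n : ℤ, ((Finset.Ico 0 |n|).card : ℝ) = |(n : ℝ)| := card_Ico_abs
  have cs : ∀ n : ℤ, n ≠ 0 → ∑ i ∈ Finset.Ico 0 |n|, ((cl n i A).card : ℝ) = A.card := by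
    intro n hn; exact_mod_cast (card_eq_sum_cl hn A).symm
  have step : ∀ i ∈ Finset.Ico 0 |q|,
      |(p : ℝ)| * (cl q i A).card + A.card - |(p : ℝ)| ≤ ((S p q (cl q i A) A).card : ℝ) := by
    intro i hi
    have hs : ((∑ j ∈ Finset.Ico 0 |p|, (S q p (cl p j A) (cl q i A)).card : ℕ) : ℝ) ≤
        (S q p A (cl q i A)).card := by
      exact_mod_cast S_split hco.symm A (cl q i A)
    rw [S_comm p q]
    refine le_trans ?_ hs
    push_cast
    have : ∀ j ∈ Finset.Ico 0 |p|, ((cl p j A).card : ℝ) + ((cl q i A).card - 1) ≤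
        (S q p (cl p j A) (cl q i A)).card := by
      intro j hj
      have : (((cl p j A).card + (cl q i A).card : ℕ) : ℝ) ≤
        ((S q p (cl p j A) (cl q i A)).card + 1 : ℕ) := by
        exact_mod_cast card_S_ge hq hp (cl_nonempty hj h1) (cl_nonempty hi h2)
      push_cast at this
      linarith
    refine le_trans (le_of_eq ?_) (Finset.sum_le_sum this)
    rw [Finset.sum_add_distrib, cs p hp, Finset.sum_const, nsmul_eq_mul, c]
    ring
  have hs : ((∑ i ∈ Finset.Ico 0 |q|, (S p q (cl q i A) A).card : ℕ) : ℝ) ≤ (S p q A A).card := by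
    exact_mod_cast S_split hco A A
  refine le_trans ?_ hs
  push_cast
  refine le_trans (le_of_eq ?_) (Finset.sum_le_sum step)
  rw [Finset.sum_sub_distrib, Finset.sum_add_distrib, ← Finset.mul_sum, cs q hq, Finset.sum_const,
    Finset.sum_const, nsmul_eq_mul, nsmul_eq_mul, c]
  ring

/-- translate inside `p·X + A`, disjoint union estimate -/
lemma two_parts {p q c a : ℤ} (hp : p ≠ 0) {X Y A : Finset ℤ} (hX : ∀ x ∈ X, c + q * x ∈ A)
    (hY : Y ⊆ X) (ha : a ∈ A)
    (hd : ∀ y ∈ Y, ∀ x ∈ X, ∀ x' ∈ X, p * y + a ≠ p * x + (c + q * x')) :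
    (S p q X X).card + Y.card ≤ (S p 1 X A).card := by
  rw [← card_af c one_ne_zero (S p q X X), ← card_af a hp Y, ← Finset.card_union_of_disjoint]
  · apply Finset.card_le_card
    intro n hn
    rw [Finset.mem_union, mem_af, mem_af] at hn
    rcases hn with ⟨_, hs, rfl⟩ | ⟨y, hy, rfl⟩
    · obtain ⟨x, hx, x', hx', rfl⟩ := mem_S.mp hs
      exact mem_S.mpr ⟨x, hx, _, hX x' hx', by ring⟩
    · exact mem_S.mpr ⟨y, hY hy, a, ha, by ring⟩
  · rw [Finset.disjoint_left]
    intro n hn hn'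
    obtain ⟨_, hs, rfl⟩ := mem_af.mp hn
    obtain ⟨x, hx, x', hx', rfl⟩ := mem_S.mp hs
    obtain ⟨y, hy, e⟩ := mem_af.mp hn'
    exact hd y hy x hx x' hx' (by linarith)

/-- Gain when `A` is fully distributed mod `p` but the piece is not. -/
lemma gain_p {p q c : ℤ} (hp : p ≠ 0) (hco : IsCoprime p q) {X A : Finset ℤ}
    (hX : ∀ x ∈ X, c + q * x ∈ A) (hA : FD p A) (h : ¬ FD p X) :
    (S p q X X).card + X.card ≤ (S p 1 X A).card := by
  unfold FD at h
  push Not at h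
  obtain ⟨r, hr⟩ := h
  obtain ⟨b, hb, hbr⟩ := hA (c + q * r)
  refine two_parts hp hX (subset_refl _) hb ?_
  intro y _ x _ x' hx' e
  apply hr x' hx'
  refine hco.dvd_of_dvd_mul_left (z := x' - r) ?_
  obtain ⟨k, hk⟩ := hbr
  exact ⟨k + y - x, by linear_combination hk - e⟩

/-- Gain when the piece is not fully distributed mod `q`. -/
lemma gain_q {p q c : ℤ} (hp : p ≠ 0) (hq : q ≠ 0) (hco : IsCoprime p q) {X A : Finset ℤ}
    (hne : X.Nonempty)
    (hX : ∀ x ∈ X, c + q * x ∈ A) (hA : Red A) (h : ¬ FD q X) :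
    ∃ k, (cl q k X).Nonempty ∧ (S p q X X).card + (cl q k X).card ≤ (S p 1 X A).card := by
  by_cases hex : ∃ x ∈ X, ∃ a ∈ A, ∀ y ∈ X, ¬ q ∣ p * x + a - c - p * y
  · obtain ⟨x, hx, a, ha, hy⟩ := hex
    refine ⟨x % q, ⟨x, mem_cl.mpr ⟨hx, rfl⟩⟩, ?_⟩
    refine two_parts hp hX (Finset.filter_subset _ _) ha ?_
    intro z hz x1 hx1 x2 hx2 e
    apply hy x1 hx1
    obtain ⟨k, hk⟩ := emod_eq_iff.mp (mem_cl.mp hz).2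
    exact ⟨x2 - p * k, by linear_combination e - p * hk⟩
  · exfalso
    push Not at hex
    apply h
    -- stabilizer
    let W : ℤ → Prop := fun w => ∃ y ∈ X, q ∣ w - p * y
    have hper : ∀ w k, W w → W (w + q * k) := by
      rintro w k ⟨y, hy, l, hl⟩
      exact ⟨y, hy, l + k, by linear_combination hl⟩
    have hmul : ∀ n : ℤ, (∀ w, W w → W (w + n)) → ∀ (j : ℕ) w, W w → W (w + j * n) := by
      intro n hn j
      induction j with
      | zero => intro w hw; simpa using hw
      | succ j ih =>
        intro w hw
        have := hn _ (ih w hw)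
        convert this using 1
        push_cast; ring
    let H : AddSubgroup ℤ :=
      { carrier := {n | ∀ w, W w → W (w + n)}
        zero_mem' := by intro w hw; simpa using hw
        add_mem' := by
          intro a b ha hb w hw
          have := hb _ (ha w hw)
          rwa [add_assoc] at this
        neg_mem' := by
          intro n hn w hw
          have h1 := hmul n hn (q.natAbs - 1) w hw
          have h2 : ((q.natAbs - 1 : ℕ) : ℤ) = |q| - 1 := by
            have : 1 ≤ q.natAbs := Int.natAbs_pos.mpr hq
            push_cast [Nat.cast_sub this]
            simp
          rw [h2] at h1
          obtain ⟨u, hu⟩ : q ∣ |q| := (dvd_abs q q).mpr dvd_rfl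
          have h3 := hper _ (-(u * n)) h1
          convert h3 using 1
          rw [hu]; ring }
    have hmem : ∀ a ∈ A, a - c ∈ H := by
      intro a ha w hw
      obtain ⟨y, hy, k, hk⟩ := hw
      obtain ⟨z, hz, l, hl⟩ := hex y hy a ha
      exact ⟨z, hz, l + k, by linear_combination hl + hk⟩
    have htop : H = ⊤ := by
      apply hA H
      intro a ha b hb
      have := H.sub_mem (hmem a ha) (hmem b hb)
      simpa using this
    intro r
    obtain ⟨x0, hx0⟩ := hne
    have hW0 : W (p * x0) := ⟨x0, hx0, by simp⟩
    have hall : p * r - p * x0 ∈ H := by rw [htop]; trivial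
    obtain ⟨y, hy, k, hk⟩ := hall _ hW0
    refine ⟨y, hy, hco.symm.dvd_of_dvd_mul_left (z := y - r) ⟨-k, by linear_combination -hk⟩⟩

lemma card_cl_split {p q k : ℤ} (hq : q ≠ 0) (hco : IsCoprime p q) {X : Finset ℤ}
    (hk : (cl q k X).Nonempty) :
    (S p q (X \ cl q k X) (X \ cl q k X)).card + X.card ≤ (S p q X X).card := by
  obtain ⟨x0, hx0⟩ := hk
  have hx0' := mem_cl.mp hx0
  rw [← card_af (p * x0) hq X, ← Finset.card_union_of_disjoint]
  · apply Finset.card_le_card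
    intro n hn
    rw [Finset.mem_union, mem_af] at hn
    rcases hn with hn | ⟨y, hy, rfl⟩
    · exact S_mono Finset.sdiff_subset Finset.sdiff_subset hn
    · exact mem_S.mpr ⟨x0, hx0'.1, y, hy, rfl⟩
  · rw [Finset.disjoint_left]
    intro n hn hn'
    obtain ⟨x, hx, y, hy, e⟩ := mem_S.mp hn
    obtain ⟨z, hz, e'⟩ := mem_af.mp hn'
    have := emod_eq_iff.mpr (dvd_of_eq hco (e.trans e'.symm))
    rw [Finset.mem_sdiff] at hx
    exact hx.2 (mem_cl.mpr ⟨hx.1, this.trans hx0'.2⟩)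

/-- Gain, quantitative. -/
lemma gain_q' {p q c : ℤ} (hp : p ≠ 0) (hq : q ≠ 0) (hco : IsCoprime p q) {X A : Finset ℤ}
    (hX : ∀ x ∈ X, c + q * x ∈ A) (hA : Red A) (h : ¬ FD q X) {m C M t : ℝ} (hm : 0 ≤ m)
    (hC : 0 ≤ C) (hmM : m ≤ M) (ht : t ≤ m + 1 / (M + 1))
    (H : ∀ A : Finset ℤ, m * A.card - C ≤ (S p q A A).card) :
    t * X.card - C ≤ (S p 1 X A).card := by
  rcases X.eq_empty_or_nonempty with rfl | hne
  · simp only [Finset.card_empty, Nat.cast_zero, mul_zero]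
    have : (0 : ℝ) ≤ (S p 1 ∅ A).card := by positivity
    linarith
  obtain ⟨k, hk, hg⟩ := gain_q hp hq hco hne hX hA h
  have hsp := card_cl_split (p := p) hq hco hk
  have hg' : ((S p q X X).card : ℝ) + (cl q k X).card ≤ (S p 1 X A).card := by exact_mod_cast hg
  have hsp' : ((S p q (X \ cl q k X) (X \ cl q k X)).card : ℝ) + X.card ≤ (S p q X X).card := by
    exact_mod_cast hsp
  have h1 := H X
  have h2 := H (X \ cl q k X)
  have h3 : ((X \ cl q k X).card : ℝ) = X.card - (cl q k X).card := by
    have := Finset.card_sdiff_add_card_eq_card (s := cl q k X) (t := X) (Finset.filter_subset _ _)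
    have : ((X \ cl q k X).card : ℝ) + (cl q k X).card = X.card := by exact_mod_cast this
    linarith
  rw [h3] at h2
  have hM : 0 < M + 1 := by linarith
  have hx : (0 : ℝ) ≤ X.card := by positivity
  have hz : (0 : ℝ) ≤ (cl q k X).card := by positivity
  have htx : t * X.card ≤ m * X.card + X.card / (M + 1) := by
    calc t * X.card ≤ (m + 1 / (M + 1)) * X.card := by gcongr
      _ = _ := by ring
  rcases le_total ((X.card : ℝ) / (M + 1)) (cl q k X).card with hle | hle
  · linarith
  · have e : M * (X.card / (M + 1)) + X.card / (M + 1) = (X.card : ℝ) := by field_simp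
    have : m * (cl q k X).card ≤ M * (X.card / (M + 1)) := by
      have hM1 : 0 ≤ M := hm.trans hmM
      gcongr
    nlinarith

def Hyp (p q : ℤ) (m : ℝ) : Prop :=
  ∃ C : ℝ, 0 ≤ C ∧ ∀ A : Finset ℤ, m * A.card - C ≤ (S p q A A).card

lemma Hyp.symm {p q : ℤ} {m : ℝ} (h : Hyp p q m) : Hyp q p m := by
  obtain ⟨C, hC, h⟩ := h
  exact ⟨C, hC, fun A => by rw [S_comm]; exact h A⟩

/-- reduction to reduced sets -/
lemma reduce {p q : ℤ} {t C M : ℝ} (hM : 0 ≤ M) (htM : t ≤ M) (hC : M ≤ C) (A : Finset ℤ)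
    (h : ∀ c g A', g ≠ 0 → A = af c g A' → Red A' → t * A'.card - C ≤ (S p q A' A').card) :
    t * A.card - C ≤ (S p q A A).card := by
  rcases le_or_gt A.card 1 with hA | hA
  · have h0 : (0 : ℝ) ≤ (S p q A A).card := by positivity
    have h1 : (A.card : ℝ) ≤ 1 := by exact_mod_cast hA
    have h2 : (0 : ℝ) ≤ A.card := by positivity
    nlinarith
  · obtain ⟨c, g, A', hg, e, hr⟩ := exists_red A hA
    have := h c g A' hg e hr
    rw [e, S_af, card_af _ hg, card_af _ hg]
    exact this

lemma L1 {p q : ℤ} (hp : p ≠ 0) (hq : q ≠ 0) (hco : IsCoprime p q) {m M t : ℝ}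
    (hM : M = |(p : ℝ)| + |(q : ℝ)|) (hm : 0 ≤ m) (hmM : m ≤ M) (ht : t ≤ m + 1 / (M + 1))
    (htM : t ≤ M) (H : Hyp p q m) :
    ∃ C : ℝ, 0 ≤ C ∧ ∀ A : Finset ℤ, FD p A → t * A.card - C ≤ (S p q A A).card := by
  obtain ⟨C, hC, H⟩ := H
  have hpq : 0 ≤ |(p : ℝ)| * |(q : ℝ)| := by positivity
  have hM0 : 0 ≤ M := by rw [hM]; positivity
  have hq1 : 0 ≤ |(q : ℝ)| := by positivity
  set C1 := C + |(p : ℝ)| * |(q : ℝ)| with hC1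
  have hC1' : 0 ≤ |(q : ℝ)| * C1 := by positivity
  refine ⟨|(q : ℝ)| * C1 + M, by positivity, ?_⟩
  intro A hA
  refine reduce hM0 htM (by linarith) A ?_
  rintro c g A' hg rfl hr
  have hA' := FD_of_af hA
  have := piece_sum hq hco A' t C1 ?_
  · linarith
  intro i X hX
  have hx : (0 : ℝ) ≤ X.card := by positivity
  by_cases h1 : FD q X
  · by_cases h2 : FD p X
    · have h3 := FD_both hp hq hco h2 h1
      have h4 : (S p q X X).card + (∅ : Finset ℤ).card ≤ (S p 1 X A').card := by
        obtain ⟨x, hx, -⟩ := h1 0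
        exact two_parts hp hX (Finset.empty_subset _) (hX x hx) (by simp)
      have h5 : ((S p q X X).card : ℝ) ≤ (S p 1 X A').card := by exact_mod_cast h4
      rw [← hM] at h3
      have : t * X.card ≤ M * X.card := by gcongr
      linarith
    · have h3 := gain_p hp hco hX hA' h2
      have h3' : ((S p q X X).card : ℝ) + X.card ≤ (S p 1 X A').card := by exact_mod_cast h3
      have h4 := H X
      have h5 : 1 / (M + 1) ≤ 1 := by
        rw [div_le_one (by linarith)]; linarith
      have : t * X.card ≤ (m + 1) * X.card := by gcongr; linarith
      linarith
  · have := gain_q' hp hq hco hX hr h1 hm hC hmM ht H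
    linarith

lemma L2 {p q : ℤ} (hp : p ≠ 0) (hq : q ≠ 0) (hco : IsCoprime p q) {m M t : ℝ}
    (hM : M = |(p : ℝ)| + |(q : ℝ)|) (hm : 0 ≤ m) (hmM : m ≤ M) (ht : t ≤ m + 1 / (M + 1))
    (htM : t ≤ M) (H : Hyp p q m) : Hyp p q t := by
  obtain ⟨C', hC', H'⟩ := L1 hq hp hco.symm (hM.trans (add_comm _ _)) hm hmM ht htM H.symm
  obtain ⟨C, hC, H⟩ := H
  have hM0 : 0 ≤ M := by rw [hM]; positivity
  have hCC : 0 ≤ |(q : ℝ)| * (C + C') := by positivity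
  refine ⟨|(q : ℝ)| * (C + C') + M, by positivity, ?_⟩
  intro A
  refine reduce hM0 htM (by linarith) A ?_
  rintro c g A' hg - hr
  have := piece_sum hq hco A' t (C + C') ?_
  · linarith
  intro i X hX
  by_cases h1 : FD q X
  · have h3 := H' X h1
    rw [S_comm] at h3
    have h4 : (S p q X X).card + (∅ : Finset ℤ).card ≤ (S p 1 X A').card := by
      obtain ⟨x, hx, -⟩ := h1 0
      exact two_parts hp hX (Finset.empty_subset _) (hX x hx) (by simp)
    have h5 : ((S p q X X).card : ℝ) ≤ (S p 1 X A').card := by exact_mod_cast h4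
    linarith
  · have := gain_q' hp hq hco hX hr h1 hm hC hmM ht H
    linarith

lemma main_int_nonzero {p q : ℤ} (hp : p ≠ 0) (hq : q ≠ 0) (hco : IsCoprime p q) :
    Hyp p q (|(p : ℝ)| + |(q : ℝ)|) := by
  set M := |(p : ℝ)| + |(q : ℝ)| with hM
  have hM0 : 0 ≤ M := by positivity
  have key : ∀ n : ℕ, Hyp p q (min (n * (1 / (M + 1))) M) := by
    intro n
    induction n with
    | zero =>
      refine ⟨0, le_rfl, fun A => ?_⟩
      simp [hM0]
    | succ n ih =>
      have hd : 0 ≤ 1 / (M + 1) := by positivity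
      refine L2 hp hq hco hM (by positivity) (min_le_right _ _) ?_ (min_le_right _ _) ih
      push_cast
      rw [add_mul, one_mul, ← min_add_add_right]
      exact min_le_min le_rfl (by linarith)
  obtain ⟨n, hn⟩ := exists_nat_ge (M * (M + 1))
  have := key n
  rwa [min_eq_right] at this
  rw [mul_one_div, le_div_iff₀ (by positivity)]
  exact hn

lemma main_zero {q : ℤ} (hco : IsCoprime 0 q) : Hyp 0 q (|((0 : ℤ) : ℝ)| + |(q : ℝ)|) := by
  have hu : IsUnit q := isCoprime_zero_left.mp hco
  have hq : |(q : ℝ)| = 1 := by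
    rcases Int.isUnit_iff.mp hu with rfl | rfl <;> simp
  refine ⟨0, le_rfl, fun A => ?_⟩
  rw [hq]
  have : A.card ≤ (S 0 q A A).card := by
    rw [← card_af 0 hu.ne_zero A]
    apply Finset.card_le_card
    intro n hn
    obtain ⟨x, hx, rfl⟩ := mem_af.mp hn
    exact mem_S.mpr ⟨x, hx, x, hx, by ring⟩
  simpa using this

lemma main_int {p q : ℤ} (hco : IsCoprime p q) : Hyp p q (|(p : ℝ)| + |(q : ℝ)|) := by
  by_cases hp : p = 0
  · subst hp; exact main_zero hco
  by_cases hq : q = 0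
  · subst hq
    have := (main_zero hco.symm).symm
    rwa [add_comm] at this
  exact main_int_nonzero hp hq hco

/-- Additive map to the integers that is injective on a finite set. -/
lemma exists_map (A : Finset ℝ) : ∃ f : ℝ → ℤ, Set.InjOn f A ∧
    ∀ q s : ℤ, ∀ x ∈ A, ∀ y ∈ A, ∀ x' ∈ A, ∀ y' ∈ A, (q : ℝ) * x + s * y = q * x' + s * y' →
      q * f x + s * f y = q * f x' + s * f y' := by
  obtain ⟨φ, hφ⟩ := Module.exists_dual_forall_apply_ne_zero (K := ℚ)
    (ι := {z : A × A // z.1 ≠ z.2}) (fun z => ((z.1.1 : ℝ) - z.1.2 : ℝ)) (by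
      rintro ⟨⟨x, y⟩, h⟩ e
      exact h (Subtype.ext (sub_eq_zero.mp e)))
  obtain ⟨b, hb⟩ := IsLocalization.exist_integer_multiples (nonZeroDivisors ℤ) A (fun x => φ x)
  have hb' : ∀ x ∈ A, ∃ n : ℤ, (n : ℚ) = (b : ℤ) * φ x := by
    intro x hx
    obtain ⟨n, hn⟩ := hb x hx
    exact ⟨n, by simpa using hn⟩
  have hb0 : ((b : ℤ) : ℚ) ≠ 0 := by
    exact_mod_cast nonZeroDivisors.ne_zero b.2
  classical
  choose! f hf using hb'
  refine ⟨f, ?_, ?_⟩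
  · intro x hx y hy e
    by_contra hne
    apply hφ ⟨⟨⟨x, hx⟩, ⟨y, hy⟩⟩, fun h => hne (congrArg Subtype.val h)⟩
    have e1 : ((f x : ℤ) : ℚ) = f y := by rw [e]
    rw [hf x hx, hf y hy] at e1
    have := mul_left_cancel₀ hb0 e1
    simp [this]
  · intro q s x hx y hy x' hx' y' hy' e
    have lin : ∀ u v : ℝ, φ ((q : ℝ) * u + s * v) = q * φ u + s * φ v := by
      intro u v
      rw [map_add]
      have h1 : ∀ (n : ℤ) (w : ℝ), φ ((n : ℝ) * w) = n * φ w := by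
        intro n w
        rw [← zsmul_eq_mul, map_zsmul, zsmul_eq_mul]
      rw [h1, h1]
    have e1 := congrArg φ e
    rw [lin, lin] at e1
    have : (q * f x + s * f y : ℚ) = q * f x' + s * f y' := by
      rw [hf x hx, hf y hy, hf x' hx', hf y' hy']
      linear_combination ((b : ℤ) : ℚ) * e1
    exact_mod_cast this

end Dil

/-- For distinct coprime integers `q, s`, there is a constant `C = C(q,s)` such
that every finite nonempty `A ⊆ ℝ` satisfies `|q·A + s·A| ≥ (|q| + |s|)|A| − C`. -/
theorem stmt5 (q s : ℤ) (hne : q ≠ s) (hco : IsCoprime q s) :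
    ∃ C : ℝ, ∀ A : Finset ℝ, A.Nonempty →
      ((|q| : ℝ) + (|s| : ℝ)) * A.card - C ≤
        (((A.image fun x => (q : ℝ) * x) + (A.image fun x => (s : ℝ) * x)).card : ℝ) := by
  obtain ⟨C, -, hC⟩ := Dil.main_int hco
  refine ⟨C, fun A _ => ?_⟩
  obtain ⟨f, hinj, hf⟩ := Dil.exists_map A
  have h1 := hC (A.image f)
  rw [Finset.card_image_of_injOn hinj] at h1
  refine h1.trans ?_
  rw [Nat.cast_le]
  -- choose preimages of the integer sums
  have hpre : ∀ n ∈ Dil.S q s (A.image f) (A.image f),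
      ∃ z : ℝ × ℝ, z.1 ∈ A ∧ z.2 ∈ A ∧ q * f z.1 + s * f z.2 = n := by
    intro n hn
    obtain ⟨x, hx, y, hy, e⟩ := Dil.mem_S.mp hn
    obtain ⟨u, hu, rfl⟩ := Finset.mem_image.mp hx
    obtain ⟨v, hv, rfl⟩ := Finset.mem_image.mp hy
    exact ⟨(u, v), hu, hv, e⟩
  choose! z hz1 hz2 hz using hpre
  apply Finset.card_le_card_of_injOn (fun n => (q : ℝ) * (z n).1 + s * (z n).2)
  · intro n hn
    exact Finset.add_mem_add (Finset.mem_image_of_mem _ (hz1 n hn))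
      (Finset.mem_image_of_mem _ (hz2 n hn))
  · intro n hn n' hn' e
    rw [← hz n hn, ← hz n' hn']
    exact hf q s _ (hz1 n hn) _ (hz2 n hn) _ (hz1 n' hn') _ (hz2 n' hn') e
end

section
/- Let d ≥ 1 and let q, s be coprime integers with qs > 1. Let A ⊆ ℝ^d be a finite d-dimensional set that can be covered by exactly d parallel lines l₁,…,l_d. Then |q·A + s·A| ≥ (|q| + |s| + 2d − 2)|A| − K·d, where K depends only on q, s, d. -/
open Pointwise

/-- The sum of dilates `p·A + q·B`. -/
def DD {E : Type*} [AddCommGroup E] [DecidableEq E] (p q : ℕ) (A B : Finset E) : Finset E :=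
  Finset.image₂ (fun x y => p • x + q • y) A B

lemma mem_DD {E : Type*} [AddCommGroup E] [DecidableEq E] {p q : ℕ} {A B : Finset E} {z : E} :
    z ∈ DD p q A B ↔ ∃ x ∈ A, ∃ y ∈ B, p • x + q • y = z := by
  simp [DD, Finset.mem_image₂]

lemma DD_swap {E : Type*} [AddCommGroup E] [DecidableEq E] (p q : ℕ) (A B : Finset E) :
    DD q p B A = DD p q A B := by
  ext z; simp only [mem_DD]
  constructor <;> rintro ⟨x, hx, y, hy, h⟩ <;> exact ⟨y, hy, x, hx, by rw [add_comm]; exact h⟩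

lemma DD_mono {E : Type*} [AddCommGroup E] [DecidableEq E] {p q : ℕ} {A B A' B' : Finset E}
    (hA : A ⊆ A') (hB : B ⊆ B') : DD p q A B ⊆ DD p q A' B' :=
  Finset.image₂_subset hA hB

/-- Cauchy-Davenport lower bound. -/
lemma DD_card {E : Type*} [AddCommGroup E] [IsAddTorsionFree E] [DecidableEq E] {p q : ℕ}
    (hp : p ≠ 0) (hq : q ≠ 0) {A B : Finset E} (hA : A.Nonempty) (hB : B.Nonempty) :
    A.card + B.card ≤ (DD p q A B).card + 1 := by
  have h : DD p q A B = A.image (fun x => p • x) + B.image (fun x => q • x) := by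
    ext z; simp only [mem_DD, Finset.mem_add, Finset.mem_image]
    constructor
    · rintro ⟨x, hx, y, hy, h⟩; exact ⟨_, ⟨x, hx, rfl⟩, _, ⟨y, hy, rfl⟩, h⟩
    · rintro ⟨_, ⟨x, hx, rfl⟩, _, ⟨y, hy, rfl⟩, h⟩; exact ⟨x, hx, y, hy, h⟩
  rw [h]
  have := cauchy_davenport_of_isAddTorsionFree (hA.image (fun x => p • x))
    (hB.image (fun x => q • x))
  rw [Finset.card_image_of_injective _ (nsmul_right_injective hp),
    Finset.card_image_of_injective _ (nsmul_right_injective hq)] at this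
  omega

lemma DD_card_right {E : Type*} [AddCommGroup E] [IsAddTorsionFree E] [DecidableEq E] {p q : ℕ}
    (hp : p ≠ 0) (hq : q ≠ 0) {A B : Finset E} (hA : A.Nonempty) :
    B.card ≤ (DD p q A B).card := by
  rcases B.eq_empty_or_nonempty with rfl | hB
  · simp
  have := DD_card hp hq hA hB
  have := hA.card_pos
  omega

lemma DD_affine {p q : ℕ} (a g : ℤ) (hg : g ≠ 0) (A : Finset ℤ) :
    (DD p q (A.image fun x => a + g * x) (A.image fun x => a + g * x)).card = (DD p q A A).card := by
  have : DD p q (A.image fun x => a + g * x) (A.image fun x => a + g * x)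
      = (DD p q A A).image (fun x => (p * a + q * a) + g * x) := by
    ext z; simp only [mem_DD, Finset.mem_image]
    constructor
    · rintro ⟨_, ⟨x, hx, rfl⟩, _, ⟨y, hy, rfl⟩, h⟩
      refine ⟨_, ⟨x, hx, y, hy, rfl⟩, ?_⟩
      rw [← h]; simp only [nsmul_eq_mul]; ring
    · rintro ⟨_, ⟨x, hx, y, hy, rfl⟩, h⟩
      refine ⟨_, ⟨x, hx, rfl⟩, _, ⟨y, hy, rfl⟩, ?_⟩
      rw [← h]; simp only [nsmul_eq_mul]; ring
  rw [this, Finset.card_image_of_injective]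
  intro x y h
  simpa [hg] using h

/-- Residue class of `A`. -/
def cls (q : ℕ) (c : ZMod q) (A : Finset ℤ) : Finset ℤ := A.filter fun x => (x : ZMod q) = c

lemma mem_cls {q : ℕ} {c : ZMod q} {A : Finset ℤ} {x : ℤ} :
    x ∈ cls q c A ↔ x ∈ A ∧ (x : ZMod q) = c := by simp [cls]

lemma cls_sub {q : ℕ} {c : ZMod q} {A : Finset ℤ} : cls q c A ⊆ A := Finset.filter_subset _ _

lemma sum_cls (q : ℕ) [NeZero q] (A : Finset ℤ) : ∑ c, (cls q c A).card = A.card :=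
  (Finset.card_eq_sum_card_fiberwise (f := fun x : ℤ => (x : ZMod q)) (t := Finset.univ)
    (by intro x _; simp)).symm

lemma coprime_cancel {p q : ℕ} (h : p.Coprime q) {a b : ZMod q} (hab : (p : ZMod q) * a = p * b) :
    a = b := by
  have := (ZMod.isUnit_iff_coprime p q).2 h
  exact this.mul_left_cancel hab

lemma sum_DD (p q : ℕ) [NeZero q] (h : p.Coprime q) (A B : Finset ℤ) :
    ∑ c, (DD p q (cls q c A) B).card ≤ (DD p q A B).card := by
  rw [← Finset.card_biUnion]
  · apply Finset.card_le_card
    intro z; simp only [Finset.mem_biUnion]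
    rintro ⟨c, -, hc⟩
    exact DD_mono cls_sub subset_rfl hc
  · intro c _ c' _ hne
    apply Finset.disjoint_left.2
    intro z hz hz'
    simp only [mem_DD, mem_cls] at hz hz'
    obtain ⟨x, ⟨_, hx⟩, y, _, e⟩ := hz
    obtain ⟨x', ⟨_, hx'⟩, y', _, e'⟩ := hz'
    apply hne
    rw [← hx, ← hx']
    apply coprime_cancel h
    have := congrArg (Int.cast : ℤ → ZMod q) (e.trans e'.symm)
    simpa using this

lemma sum_DD_right (p q : ℕ) [NeZero p] (h : p.Coprime q) (A B : Finset ℤ) :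
    ∑ c, (DD p q A (cls p c B)).card ≤ (DD p q A B).card := by
  have := sum_DD q p h.symm B A
  simpa only [DD_swap] using this

def FD (q : ℕ) (A : Finset ℤ) : Prop := ∀ c : ZMod q, (cls q c A).Nonempty

lemma fd_bound (p q : ℕ) [NeZero p] [NeZero q] (h : p.Coprime q) (A : Finset ℤ)
    (h1 : FD p A) (h2 : FD q A) : (p + q) * A.card ≤ (DD p q A A).card + p * q := by
  have e1 := sum_DD p q h A A
  have e2 : ∀ c : ZMod q, p * (cls q c A).card + A.card ≤ (DD p q (cls q c A) A).card + p := by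
    intro c
    have e3 := sum_DD_right p q h (cls q c A) A
    have e4 : ∑ e : ZMod p, ((cls q c A).card + (cls p e A).card) ≤
        ∑ e : ZMod p, ((DD p q (cls q c A) (cls p e A)).card + 1) :=
      Finset.sum_le_sum fun e _ => DD_card (NeZero.ne p) (NeZero.ne q) (h2 c) (h1 e)
    rw [Finset.sum_add_distrib, Finset.sum_add_distrib, sum_cls] at e4
    simp [ZMod.card] at e4
    omega
  have e5 := Finset.sum_le_sum fun c (_ : c ∈ Finset.univ) => e2 c
  rw [Finset.sum_add_distrib, Finset.sum_add_distrib, ← Finset.mul_sum, sum_cls] at e5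
  simp [ZMod.card] at e5
  nlinarith

/-- `A` is not contained in a coset of a proper subgroup. -/
def Red (A : Finset ℤ) : Prop := ∀ H : AddSubgroup ℤ, (∀ x ∈ A, ∀ y ∈ A, x - y ∈ H) → H = ⊤

lemma exists_red (A : Finset ℤ) (hA : 1 < A.card) :
    ∃ (a g : ℤ) (B : Finset ℤ), g ≠ 0 ∧ A = B.image (fun x => a + g * x) ∧ Red B := by
  obtain ⟨a, ha, b, hb, hab⟩ := Finset.one_lt_card.1 hA
  obtain ⟨f, hf, hf1⟩ := Finset.extract_gcd (s := A) (fun x => x - a) ⟨a, ha⟩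
  have hg : A.gcd (fun x => x - a) ≠ 0 := by
    intro h0
    have := Finset.gcd_eq_zero_iff.1 h0 b hb
    exact hab (by linarith)
  refine ⟨a, A.gcd (fun x => x - a), A.image f, hg, ?_, ?_⟩
  · rw [Finset.image_image]
    conv_lhs => rw [← Finset.image_id (s := A)]
    apply Finset.image_congr
    intro x hx
    have := hf x hx
    simp only [id, Function.comp]
    linarith
  · intro H hH
    obtain ⟨m, rfl⟩ := Int.subgroup_cyclic H
    have h0 : f a = 0 := by
      have := hf a ha
      simp only [sub_self] at this
      exact (mul_eq_zero.1 this.symm).resolve_left hg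
    have : m ∣ A.gcd f := by
      apply Finset.dvd_gcd
      intro x hx
      have := hH (f x) (Finset.mem_image_of_mem _ hx) (f a) (Finset.mem_image_of_mem _ ha)
      rw [h0, sub_zero, AddSubgroup.mem_closure_singleton] at this
      obtain ⟨n, hn⟩ := this
      exact ⟨n, by rw [← hn]; simp [mul_comm]⟩
    rw [hf1] at this
    obtain ⟨k, hk⟩ := this
    rw [eq_top_iff]
    intro x _
    rw [AddSubgroup.mem_closure_singleton]
    exact ⟨x * k, by simp only [smul_eq_mul]; rw [mul_assoc, mul_comm k, ← hk, mul_one]⟩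

lemma FD_of_affine (q : ℕ) [NeZero q] (a g : ℤ) (A : Finset ℤ) (h : FD q (A.image fun x => a + g * x)) :
    FD q A := by
  have hs : Function.Surjective (fun c : ZMod q => (a : ZMod q) + g * c) := by
    intro c
    obtain ⟨y, hy⟩ := h c
    simp only [mem_cls, Finset.mem_image] at hy
    obtain ⟨⟨x, hx, rfl⟩, e⟩ := hy
    exact ⟨(x : ZMod q), by simpa using e⟩
  have hi := Finite.injective_iff_surjective.2 hs
  intro c
  obtain ⟨y, hy⟩ := h ((a : ZMod q) + g * c)
  simp only [mem_cls, Finset.mem_image] at hy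
  obtain ⟨⟨x, hx, rfl⟩, e⟩ := hy
  exact ⟨x, mem_cls.2 ⟨hx, hi (by simpa using e)⟩⟩

lemma stab_full (p q : ℕ) [NeZero q] (h : p.Coprime q) (A : Finset ℤ) (hA : Red A) (i : ℤ)
    (T : Set (ZMod q)) (hT : T.Nonempty)
    (hyp : ∀ w ∈ A, ∀ t ∈ T, ∃ t2 ∈ T, (p : ZMod q) * t + w = p * t2 + i) : ∀ c, c ∈ T := by
  let S0 : AddSubmonoid ℤ :=
    { carrier := {m | ∀ t ∈ T, t + (m : ZMod q) ∈ T}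
      zero_mem' := by intro t ht; simpa using ht
      add_mem' := by
        intro a b ha hb t ht
        have := hb _ (ha t ht)
        push_cast
        rwa [← add_assoc] }
  have hcast : ∀ m n : ℤ, (m : ZMod q) = n → m ∈ S0 → n ∈ S0 := by
    intro m n hmn hm t ht
    have := hm t ht
    rwa [hmn] at this
  let S : AddSubgroup ℤ :=
    { S0 with
      neg_mem' := by
        intro m hm
        have h1 := S0.nsmul_mem hm (q - 1)
        refine hcast _ _ ?_ h1
        have : 1 ≤ q := Nat.one_le_iff_ne_zero.2 (NeZero.ne q)
        simp [Nat.cast_sub this] }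
  have hu := (ZMod.isUnit_iff_coprime p q).2 h
  have key : ∀ w ∈ A, w - i ∈ S := by
    intro w hw
    obtain ⟨u, hu'⟩ := hu.exists_left_inv
    obtain ⟨v, rfl⟩ := ZMod.intCast_surjective u
    have h1 : v * (w - i) ∈ S0 := by
      intro t ht
      obtain ⟨t2, ht2, e⟩ := hyp w hw t ht
      have : t + ((v * (w - i) : ℤ) : ZMod q) = t2 := by
        push_cast
        linear_combination (v : ZMod q) * e + (t2 - t) * hu'
      rw [this]; exact ht2
    have h2 := S0.nsmul_mem h1 p
    refine hcast _ _ ?_ h2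
    push_cast [nsmul_eq_mul]
    linear_combination ((w : ZMod q) - i) * hu'
  have htop := hA S (by
    intro x hx y hy
    have := S.sub_mem (key x hx) (key y hy)
    simpa using this)
  obtain ⟨t, ht⟩ := hT
  intro c
  obtain ⟨m, hm⟩ := ZMod.intCast_surjective (c - t)
  have : m ∈ S := by rw [htop]; trivial
  have := this t ht
  rw [hm] at this
  simpa using this

lemma mod_quot (q : ℕ) (x i : ℤ) (h : (x : ZMod q) = i) : x = i % q + q * (x / q) := by
  have := (ZMod.intCast_eq_intCast_iff x i q).1 h
  have h2 : x % q = i % q := this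
  rw [← h2]; exact (Int.emod_add_mul_ediv x q).symm

/-- Quotient of a residue class. -/
def quo (q : ℕ) (A : Finset ℤ) : Finset ℤ := A.image (fun x => x / (q : ℤ))

lemma cls_quo (q : ℕ) (i : ℤ) (A : Finset ℤ) :
    cls q (i : ZMod q) A = (quo q (cls q (i : ZMod q) A)).image (fun x => i % q + q * x) := by
  rw [quo, Finset.image_image]
  conv_lhs => rw [← Finset.image_id (s := cls q (i : ZMod q) A)]
  apply Finset.image_congr
  intro x hx
  exact mod_quot q x i (mem_cls.1 hx).2

lemma gain (p q : ℕ) [NeZero p] [NeZero q] (h : p.Coprime q) (n C : ℕ)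
    (hn : n ≤ (p + q) * (p + q + 1))
    (hb : ∀ B : Finset ℤ, n * B.card ≤ (p + q + 1) * (DD p q B B).card + C)
    (A : Finset ℤ) (hA : Red A) :
    (n + 1) * A.card ≤ (p + q + 1) * (DD p q A A).card + q * C ∨
    (∀ i ∈ A, (∀ e : ZMod q, ∃ x ∈ cls q (i : ZMod q) A, ((x / (q : ℤ) : ℤ) : ZMod q) = e) ∧
      ∀ w ∈ A, ∃ x ∈ cls q (i : ZMod q) A, (x : ZMod p) = w) := by
  by_cases hg : ∃ c, n * (cls q c A).card + A.card ≤ (p + q + 1) * (DD p q (cls q c A) A).card + C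
  · left
    obtain ⟨c0, hc0⟩ := hg
    have e1 := sum_DD p q h A A
    have e2 : ∑ c : ZMod q, (n * (cls q c A).card + if c = c0 then A.card else 0) ≤
        ∑ c : ZMod q, ((p + q + 1) * (DD p q (cls q c A) A).card + C) := by
      apply Finset.sum_le_sum
      intro c _
      split_ifs with hc
      · subst hc; exact hc0
      · have h1 := hb (cls q c A)
        have h2 := Finset.card_le_card (DD_mono (p := p) (q := q) (subset_refl (cls q c A)) (cls_sub (q := q) (c := c) (A := A)))
        nlinarith
    rw [Finset.sum_add_distrib, Finset.sum_add_distrib, ← Finset.mul_sum, ← Finset.mul_sum, sum_cls] at e2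
    simp [ZMod.card] at e2
    nlinarith
  right
  push Not at hg
  have hbig : ∀ w ∈ A, A.card < (p + q + 1) * (cls q (w : ZMod q) A).card := by
    intro w hw
    have h1 := hg (w : ZMod q)
    have h2 := DD_card_right (NeZero.ne p) (NeZero.ne q) (B := A)
      (⟨w, mem_cls.2 ⟨hw, rfl⟩⟩ : (cls q (w : ZMod q) A).Nonempty)
    have hpos : 0 < p + q := by have := NeZero.ne p; omega
    have h3 : (p + q) * A.card < (p + q) * ((p + q + 1) * (cls q (w : ZMod q) A).card) := by
      nlinarith
    exact Nat.lt_of_mul_lt_mul_left h3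
  have hno : ∀ i ∈ A, ∀ w ∈ A, ∀ X : Finset ℤ, X ⊆ DD p q (cls q (i : ZMod q) A) A →
      Disjoint (DD p q (cls q (i : ZMod q) A) (cls q (i : ZMod q) A)) X →
      (cls q (w : ZMod q) A).card ≤ X.card → False := by
    intro i hi w hw X hX hd hc
    have h1 := hg (i : ZMod q)
    have h2 := hb (cls q (i : ZMod q) A)
    have h3 := Finset.card_le_card (Finset.union_subset
      (DD_mono (p := p) (q := q) (subset_refl (cls q (i : ZMod q) A)) (cls_sub (q := q) (c := (i : ZMod q)) (A := A))) hX)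
    rw [Finset.card_union_of_disjoint hd] at h3
    have h4 := hbig w hw
    nlinarith
  intro i hi
  constructor
  · have := stab_full p q h A hA i
      {e | ∃ x ∈ cls q (i : ZMod q) A, ((x / (q : ℤ) : ℤ) : ZMod q) = e}
      ⟨_, i, mem_cls.2 ⟨hi, rfl⟩, rfl⟩ ?_
    · exact this
    rintro w hw _ ⟨x, hx, rfl⟩
    by_contra hcon
    apply hno i hi w hw (DD p q {x} (cls q (w : ZMod q) A))
    · exact DD_mono (by simpa using hx) cls_sub
    · rw [Finset.disjoint_left]
      intro z hz hz'
      simp only [mem_DD, Finset.mem_singleton] at hz hz'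
      obtain ⟨x2, hx2, y2, hy2, e⟩ := hz
      obtain ⟨x', hx', y, hy, e'⟩ := hz'
      subst x'
      apply hcon
      refine ⟨_, ⟨x2, hx2, rfl⟩, ?_⟩
      rw [← (mem_cls.1 hy).2, ← (mem_cls.1 hy2).2]
      have a1 := mod_quot q _ i (mem_cls.1 hx).2
      have a2 := mod_quot q _ i (mem_cls.1 hx2).2
      have hq : (q : ℤ) ≠ 0 := by exact_mod_cast NeZero.ne q
      have e3 := e'.trans e.symm
      simp only [nsmul_eq_mul] at e3
      have a3 : (p : ℤ) * (x / q) + y = p * (x2 / q) + y2 := by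
        apply mul_left_cancel₀ hq
        linear_combination e3 - p * a1 + p * a2
      have := congrArg (Int.cast : ℤ → ZMod q) a3
      push_cast at this
      exact this
    · exact DD_card_right (NeZero.ne p) (NeZero.ne q) (Finset.singleton_nonempty x)
  · intro w hw
    by_contra hcon
    push Not at hcon
    apply hno i hi i hi (DD p q (cls q (i : ZMod q) A) {w})
    · exact DD_mono subset_rfl (by simpa using hw)
    · rw [Finset.disjoint_left]
      intro z hz hz'
      simp only [mem_DD, Finset.mem_singleton] at hz hz'
      obtain ⟨x2, hx2, y2, hy2, e⟩ := hz
      obtain ⟨x, hx, _, rfl, e'⟩ := hz'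
      apply hcon y2 hy2
      apply coprime_cancel h.symm
      have := congrArg (Int.cast : ℤ → ZMod p) (e.trans e'.symm)
      simpa using this
    · have := DD_card_right (NeZero.ne q) (NeZero.ne p) (Finset.singleton_nonempty w)
        (B := cls q (i : ZMod q) A)
      rwa [DD_swap] at this

lemma quo_card (q : ℕ) [NeZero q] (i : ℤ) (A : Finset ℤ) :
    (quo q (cls q (i : ZMod q) A)).card = (cls q (i : ZMod q) A).card := by
  have hq : (q : ℤ) ≠ 0 := by exact_mod_cast NeZero.ne q
  conv_rhs => rw [cls_quo q i A]
  rw [Finset.card_image_of_injective]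
  intro x y h
  exact mul_left_cancel₀ hq (add_left_cancel h)

lemma quo_DD (p q r : ℕ) [NeZero r] (i : ℤ) (A : Finset ℤ) :
    (DD p q (quo r (cls r (i : ZMod r) A)) (quo r (cls r (i : ZMod r) A))).card =
    (DD p q (cls r (i : ZMod r) A) (cls r (i : ZMod r) A)).card := by
  have hr : (r : ℤ) ≠ 0 := by exact_mod_cast NeZero.ne r
  conv_rhs => rw [cls_quo r i A]
  rw [DD_affine _ _ hr]

lemma DD_classes (p q : ℕ) [NeZero q] (h : p.Coprime q) (N M C : ℕ) (A : Finset ℤ)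
    (hyp : ∀ i ∈ A, N * (cls q (i : ZMod q) A).card ≤
      M * (DD p q (cls q (i : ZMod q) A) (cls q (i : ZMod q) A)).card + C) :
    N * A.card ≤ M * (DD p q A A).card + q * C := by
  have e1 := sum_DD p q h A A
  have e2 : ∑ c : ZMod q, (N * (cls q c A).card) ≤
      ∑ c : ZMod q, (M * (DD p q (cls q c A) A).card + C) := by
    apply Finset.sum_le_sum
    intro c _
    rcases (cls q c A).eq_empty_or_nonempty with h0 | ⟨i, hi⟩
    · simp [h0]
    · obtain ⟨hi', rfl⟩ := mem_cls.1 hi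
      have h1 := hyp i hi'
      have h2 := Finset.card_le_card (DD_mono (p := p) (q := q)
        (subset_refl (cls q (i : ZMod q) A)) (cls_sub (q := q) (c := (i : ZMod q)) (A := A)))
      nlinarith
  rw [Finset.sum_add_distrib, ← Finset.mul_sum, ← Finset.mul_sum, sum_cls] at e2
  simp [ZMod.card] at e2
  nlinarith

lemma level1 (p q : ℕ) [NeZero p] [NeZero q] (h : p.Coprime q) (n C : ℕ)
    (hn : n + 1 ≤ (p + q) * (p + q + 1))
    (hb : ∀ B : Finset ℤ, n * B.card ≤ (p + q + 1) * (DD p q B B).card + C)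
    (A : Finset ℤ) (hA : Red A) (hF : FD p A) :
    (n + 1) * A.card ≤ (p + q + 1) * (DD p q A A).card + (q * C + q * ((p + q + 1) * (p * q))) := by
  rcases gain p q h n C (by omega) hb A hA with h1 | h1
  · omega
  have := DD_classes p q h (n + 1) (p + q + 1) ((p + q + 1) * (p * q)) A ?_
  · omega
  intro i hi
  obtain ⟨h2, h3⟩ := h1 i hi
  have f1 : FD q (quo q (cls q (i : ZMod q) A)) := by
    intro c
    obtain ⟨x, hx, e⟩ := h2 c
    exact ⟨x / q, mem_cls.2 ⟨Finset.mem_image_of_mem _ hx, e⟩⟩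
  have f2 : FD p (quo q (cls q (i : ZMod q) A)) := by
    apply FD_of_affine p (i % q) q
    rw [← cls_quo]
    intro c
    obtain ⟨w, hw⟩ := hF c
    obtain ⟨hw', rfl⟩ := mem_cls.1 hw
    obtain ⟨x, hx, e⟩ := h3 w hw'
    exact ⟨x, mem_cls.2 ⟨hx, e⟩⟩
  have := fd_bound p q h _ f2 f1
  rw [quo_DD, quo_card] at this
  have h5 := Nat.mul_le_mul_left (p + q + 1) this
  have h6 := Nat.mul_le_mul_right (cls q (i : ZMod q) A).card hn
  nlinarith

lemma level1' (p q : ℕ) [NeZero p] [NeZero q] (h : p.Coprime q) (n C : ℕ)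
    (hn : n + 1 ≤ (p + q) * (p + q + 1))
    (hb : ∀ B : Finset ℤ, n * B.card ≤ (p + q + 1) * (DD p q B B).card + C)
    (A : Finset ℤ) (hF : FD p A) :
    (n + 1) * A.card ≤ (p + q + 1) * (DD p q A A).card +
      (q * C + q * ((p + q + 1) * (p * q)) + (n + 1)) := by
  by_cases hc : 1 < A.card
  · obtain ⟨a, g, B, hg, rfl, hB⟩ := exists_red A hc
    have := level1 p q h n C hn hb B hB (FD_of_affine p a g B hF)
    rw [DD_affine _ _ hg, Finset.card_image_of_injective]
    · omega
    · intro x y h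
      simpa [hg] using h
  · have : (n + 1) * A.card ≤ (n + 1) * 1 := Nat.mul_le_mul_left _ (by omega)
    omega

lemma level2 (p q : ℕ) [NeZero p] [NeZero q] (h : p.Coprime q) (n C : ℕ)
    (hn : n + 1 ≤ (p + q) * (p + q + 1))
    (hb : ∀ B : Finset ℤ, n * B.card ≤ (p + q + 1) * (DD p q B B).card + C)
    (A : Finset ℤ) (hA : Red A) :
    (n + 1) * A.card ≤ (p + q + 1) * (DD p q A A).card +
      (p * C + p * (q * C + q * ((p + q + 1) * (p * q)) + (n + 1))) := by
  have hg := gain q p h.symm n C (by rw [add_comm q p]; omega)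
    (by intro B; rw [DD_swap, add_comm q p]; exact hb B) A hA
  rw [DD_swap, add_comm q p] at hg
  rcases hg with h1 | h1
  · omega
  have := DD_classes q p h.symm (n + 1) (p + q + 1)
    (q * C + q * ((p + q + 1) * (p * q)) + (n + 1)) A ?_
  · rw [DD_swap] at this
    omega
  intro i hi
  obtain ⟨h2, -⟩ := h1 i hi
  have f1 : FD p (quo p (cls p (i : ZMod p) A)) := by
    intro c
    obtain ⟨x, hx, e⟩ := h2 c
    exact ⟨x / p, mem_cls.2 ⟨Finset.mem_image_of_mem _ hx, e⟩⟩
  have := level1' p q h n C hn hb _ f1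
  rw [quo_DD, quo_card] at this
  rw [DD_swap]
  exact this

lemma level3 (p q : ℕ) [NeZero p] [NeZero q] (h : p.Coprime q) (n : ℕ)
    (hn : n ≤ (p + q) * (p + q + 1)) :
    ∃ C, ∀ A : Finset ℤ, n * A.card ≤ (p + q + 1) * (DD p q A A).card + C := by
  induction n with
  | zero => exact ⟨0, by simp⟩
  | succ n ih =>
    obtain ⟨C, hC⟩ := ih (by omega)
    refine ⟨(p * C + p * (q * C + q * ((p + q + 1) * (p * q)) + (n + 1))) + (n + 1), ?_⟩
    intro A
    by_cases hc : 1 < A.card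
    · obtain ⟨a, g, B, hg, rfl, hB⟩ := exists_red A hc
      have := level2 p q h n C hn hC B hB
      rw [DD_affine _ _ hg, Finset.card_image_of_injective]
      · omega
      · intro x y h
        simpa [hg] using h
    · have : (n + 1) * A.card ≤ (n + 1) * 1 := Nat.mul_le_mul_left _ (by omega)
      omega

lemma int_bound (p q : ℕ) [NeZero p] [NeZero q] (h : p.Coprime q) :
    ∃ C, ∀ A : Finset ℤ, (p + q) * A.card ≤ (DD p q A A).card + C := by
  obtain ⟨C, hC⟩ := level3 p q h _ le_rfl
  refine ⟨C, fun A => ?_⟩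
  have := hC A
  have h2 : (p + q + 1) * ((p + q) * A.card) ≤ (p + q + 1) * ((DD p q A A).card + C) := by
    nlinarith
  exact Nat.le_of_mul_le_mul_left h2 (by omega)

/-- Balog-Shakan bound in any rational vector space. -/
lemma vs_bound (p q : ℕ) [NeZero p] [NeZero q] (h : p.Coprime q) :
    ∃ C, ∀ (E : Type) [AddCommGroup E] [Module ℚ E] [DecidableEq E] (A : Finset E),
      (p + q) * A.card ≤ (DD p q A A).card + C := by
  obtain ⟨C, hC⟩ := int_bound p q h
  refine ⟨C, fun E _ _ _ A => ?_⟩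
  obtain ⟨f, hf⟩ := Module.exists_dual_forall_apply_ne_zero (K := ℚ)
    (fun z : {z : A × A // z.1 ≠ z.2} => (z.1.1 : E) - z.1.2) (by
      rintro ⟨⟨x, y⟩, hxy⟩ h0
      exact hxy (Subtype.ext (sub_eq_zero.1 h0)))
  have hinj : Set.InjOn f (A : Set E) := by
    intro x hx y hy hxy
    by_contra hne
    apply hf ⟨⟨⟨x, hx⟩, ⟨y, hy⟩⟩, fun h => hne (congrArg Subtype.val h)⟩
    simp [hxy]
  let N : ℕ := ∏ x ∈ A, (f x).den
  have hN : (N : ℚ) ≠ 0 := by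
    simp [N, Finset.prod_eq_zero_iff]
  have hint : ∀ x ∈ A, ((N * f x).num : ℚ) = N * f x := by
    intro x hx
    obtain ⟨k, hk⟩ := Finset.dvd_prod_of_mem (fun x => (f x).den) hx
    have : (N : ℚ) * f x = ((k * (f x).num : ℤ) : ℚ) := by
      have h1 : (N : ℚ) = (f x).den * k := by exact_mod_cast hk
      rw [h1]; push_cast
      have := Rat.mul_den_eq_num (f x)
      linear_combination (k : ℚ) * this
    rw [this, Rat.num_intCast]
  have hB := hC (A.image fun x => (N * f x).num)
  rw [Finset.card_image_of_injOn] at hB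
  · have : (DD p q (A.image fun x => (N * f x).num) (A.image fun x => (N * f x).num)).card
        ≤ (DD p q A A).card := by
      have : DD p q (A.image fun x => (N * f x).num) (A.image fun x => (N * f x).num) ⊆
          (DD p q A A).image fun x => (N * f x).num := by
        intro z hz
        simp only [mem_DD, Finset.mem_image] at hz ⊢
        obtain ⟨_, ⟨x, hx, rfl⟩, _, ⟨y, hy, rfl⟩, e⟩ := hz
        refine ⟨_, ⟨x, hx, y, hy, rfl⟩, ?_⟩
        rw [← e]
        have : (N : ℚ) * f (p • x + q • y) = ((p • (N * f x).num + q • (N * f y).num : ℤ) : ℚ) := by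
          push_cast [nsmul_eq_mul]
          rw [hint x hx, hint y hy]
          simp only [map_add, map_nsmul, nsmul_eq_mul]
          ring
        rw [this]; exact Rat.num_intCast _
      exact (Finset.card_le_card this).trans Finset.card_image_le
    omega
  · intro x hx y hy hxy
    apply hinj hx hy
    apply mul_left_cancel₀ hN
    rw [← hint x hx, ← hint y hy]
    exact_mod_cast hxy

lemma fiber_bound (p q C : ℕ) (hp : p ≠ 0) (hq : q ≠ 0) {E W ι : Type} [AddCommGroup E]
    [IsAddTorsionFree E] [DecidableEq E] [AddCommGroup W] [Fintype ι] [DecidableEq ι]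
    (hC : ∀ A : Finset E, (p + q) * A.card ≤ (DD p q A A).card + C)
    (π : E →+ W) (b : ι → W) (f : E → ι) (A : Finset E) (hf : ∀ x ∈ A, π x = b (f x))
    (hne : ∀ i, ∃ x ∈ A, f x = i)
    (hinj : ∀ i j k l, p • b i + q • b j = p • b k + q • b l → i = k ∧ j = l) :
    (p + q - 2) * A.card + 2 * Fintype.card ι * A.card ≤
      (DD p q A A).card + (Fintype.card ι * C + Fintype.card ι * Fintype.card ι) := by
  let F : ι → Finset E := fun i => A.filter fun x => f x = i
  have hsum : ∑ i, (F i).card = A.card :=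
    (Finset.card_eq_sum_card_fiberwise (f := f) (t := Finset.univ) (by intro x _; simp)).symm
  have hFne : ∀ i, (F i).Nonempty := by
    intro i
    obtain ⟨x, hx, e⟩ := hne i
    exact ⟨x, Finset.mem_filter.2 ⟨hx, e⟩⟩
  have h1 : ∑ z : ι × ι, (DD p q (F z.1) (F z.2)).card ≤ (DD p q A A).card := by
    rw [← Finset.card_biUnion]
    · apply Finset.card_le_card
      intro z; simp only [Finset.mem_biUnion]
      rintro ⟨c, -, hc⟩
      exact DD_mono (Finset.filter_subset _ _) (Finset.filter_subset _ _) hc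
    · rintro ⟨i, j⟩ _ ⟨k, l⟩ _ hne
      apply Finset.disjoint_left.2
      intro z hz hz'
      simp only [mem_DD, F, Finset.mem_filter] at hz hz'
      obtain ⟨x, ⟨hx, rfl⟩, y, ⟨hy, rfl⟩, e⟩ := hz
      obtain ⟨x', ⟨hx', rfl⟩, y', ⟨hy', rfl⟩, e'⟩ := hz'
      apply hne
      have := congrArg π (e.trans e'.symm)
      simp only [map_add, map_nsmul, hf x hx, hf y hy, hf x' hx', hf y' hy'] at this
      obtain ⟨h1, h2⟩ := hinj _ _ _ _ this
      rw [h1, h2]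
  have h2 : ∑ z : ι × ι, ((if z.1 = z.2 then (p + q - 2) * (F z.1).card else 0) +
      ((F z.1).card + (F z.2).card)) ≤
      ∑ z : ι × ι, ((DD p q (F z.1) (F z.2)).card + ((if z.1 = z.2 then C else 0) + 1)) := by
    apply Finset.sum_le_sum
    rintro ⟨i, j⟩ _
    by_cases hij : i = j
    · subst hij
      have := hC (F i)
      have e : p + q = (p + q - 2) + 2 := by omega
      simp only [if_true]
      rw [e, add_mul] at this
      omega
    · have := DD_card hp hq (hFne i) (hFne j)
      simp only [hij, if_false]
      omega
  simp only [Finset.sum_add_distrib, Fintype.sum_prod_type, Finset.sum_ite_eq, Finset.mem_univ,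
    if_true, ← Finset.mul_sum, hsum, Finset.sum_const, Finset.card_univ, smul_eq_mul,
    Fintype.card_prod] at h2
  simp only [Fintype.sum_prod_type] at h1
  nlinarith

lemma geom (d : ℕ) (v : Fin d → ℝ) (hv : v ≠ 0) (a : Fin d → (Fin d → ℝ))
    (A : Finset (Fin d → ℝ)) (f : (Fin d → ℝ) → Fin d)
    (hf : ∀ x ∈ A, (ℝ ∙ v).mkQ x = (ℝ ∙ v).mkQ (a (f x)))
    (hs : affineSpan ℝ (A : Set (Fin d → ℝ)) = ⊤) :
    (∀ i, ∃ x ∈ A, f x = i) ∧ AffineIndependent ℝ (fun i => (ℝ ∙ v).mkQ (a i)) := by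
  obtain ⟨m, rfl⟩ : ∃ m, d = m + 1 := by
    cases d with
    | zero => exact absurd (Subsingleton.elim v 0) hv
    | succ m => exact ⟨m, rfl⟩
  set b : Fin (m + 1) → ((Fin (m + 1) → ℝ) ⧸ (ℝ ∙ v)) := fun i => (ℝ ∙ v).mkQ (a i) with hb
  have hdim : Module.finrank ℝ ((Fin (m + 1) → ℝ) ⧸ (ℝ ∙ v)) = m := by
    have := Submodule.finrank_quotient_add_finrank (ℝ ∙ v)
    rw [finrank_span_singleton hv] at this
    simpa using this
  have hv1 : vectorSpan ℝ (A : Set (Fin (m + 1) → ℝ)) = ⊤ := by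
    rw [← direction_affineSpan, hs, AffineSubspace.direction_top]
  have hv2 : vectorSpan ℝ ((ℝ ∙ v).mkQ '' (A : Set (Fin (m + 1) → ℝ))) = ⊤ := by
    have := AffineMap.vectorSpan_image_eq_submodule_map (ℝ ∙ v).mkQ.toAffineMap
      (s := (A : Set (Fin (m + 1) → ℝ)))
    rw [hv1] at this
    simp only [LinearMap.toAffineMap_linear, Submodule.map_top, Submodule.range_mkQ] at this
    exact this.symm
  classical
  have hAne : A.Nonempty := by
    rw [Finset.nonempty_iff_ne_empty]
    rintro rfl
    simp at hs
  have hv3 : vectorSpan ℝ (((A.image f).image b : Finset _) : Set ((Fin (m + 1) → ℝ) ⧸ (ℝ ∙ v))) = ⊤ := by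
    rw [eq_top_iff, ← hv2]
    apply vectorSpan_mono
    rintro _ ⟨x, hx, rfl⟩
    simp only [Finset.coe_image, Set.mem_image]
    exact ⟨f x, ⟨x, hx, rfl⟩, (hf x hx).symm⟩
  constructor
  · have hpos : 0 < (A.image f).card := (hAne.image f).card_pos
    obtain ⟨k, hk⟩ : ∃ k, (A.image f).card = k + 1 := ⟨_, (Nat.sub_add_cancel hpos).symm⟩
    have h1 := finrank_vectorSpan_image_finset_le ℝ b (A.image f) hk
    rw [hv3, finrank_top, hdim] at h1
    have h2 : A.image f = Finset.univ := by
      apply Finset.eq_univ_of_card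
      have := Finset.card_le_univ (A.image f)
      simp at this ⊢
      omega
    intro i
    have : i ∈ A.image f := by rw [h2]; exact Finset.mem_univ i
    simpa using this
  · rw [affineIndependent_iff_le_finrank_vectorSpan ℝ b (n := m) (by simp)]
    have : vectorSpan ℝ (Set.range b) = ⊤ := by
      rw [eq_top_iff, ← hv3]
      apply vectorSpan_mono
      intro z
      simp only [Finset.coe_image, Set.mem_image]
      rintro ⟨i, _, rfl⟩
      exact ⟨i, rfl⟩
    rw [this, finrank_top, hdim]

lemma indep_inj (p q : ℕ) (hp : p ≠ 0) (hq : q ≠ 0) (hpq : p ≠ q) {W ι : Type} [AddCommGroup W]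
    [Module ℝ W] [Fintype ι] [DecidableEq ι] (b : ι → W) (hb : AffineIndependent ℝ b) (i j k l : ι)
    (h : p • b i + q • b j = p • b k + q • b l) : i = k ∧ j = l := by
  rw [affineIndependent_iff] at hb
  have key := hb Finset.univ (fun x => (if x = i then (p : ℝ) else 0) + (if x = j then (q : ℝ) else 0)
    - (if x = k then (p : ℝ) else 0) - (if x = l then (q : ℝ) else 0))
    (by simp [Finset.sum_add_distrib, Finset.sum_sub_distrib])
    (by
      simp only [Finset.sum_add_distrib, Finset.sum_sub_distrib, sub_smul, add_smul, ite_smul,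
        zero_smul, Finset.sum_ite_eq', Finset.mem_univ, if_true, Nat.cast_smul_eq_nsmul]
      rw [h]; abel)
  have hp' : (0 : ℝ) < p := by exact_mod_cast Nat.pos_of_ne_zero hp
  have hq' : (0 : ℝ) < q := by exact_mod_cast Nat.pos_of_ne_zero hq
  have hpq' : (p : ℝ) ≠ q := by exact_mod_cast hpq
  have ki := key i (Finset.mem_univ _)
  have kj := key j (Finset.mem_univ _)
  have kk := key k (Finset.mem_univ _)
  have kl := key l (Finset.mem_univ _)
  simp only [if_true] at ki kj kk kl
  clear key h hb
  by_cases h1 : i = k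
  · subst h1
    refine ⟨rfl, ?_⟩
    by_contra h2
    simp only [if_true, h2, if_false] at kj
    linarith
  · exfalso
    by_cases h2 : i = l
    · subst h2
      by_cases h3 : i = j
      · subst h3
        simp only [if_true, h1, if_false] at ki
        linarith
      · simp only [if_true, h1, h3, if_false] at ki
        apply hpq'; linarith
    · simp only [h1, h2, if_false] at ki
      split_ifs at ki <;> linarith

lemma nat_main (d p q : ℕ) [NeZero p] [NeZero q] (h : p.Coprime q) (hpq : p ≠ q) :
    ∃ K : ℕ, ∀ (v : Fin d → ℝ), v ≠ 0 →
      ∀ (a : Fin d → (Fin d → ℝ)) (A : Finset (Fin d → ℝ)),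
        (∀ x ∈ A, ∃ (i : Fin d) (t : ℝ), x = a i + t • v) →
        affineSpan ℝ (A : Set (Fin d → ℝ)) = ⊤ →
        (p + q - 2) * A.card + 2 * d * A.card ≤ (DD p q A A).card + K * d := by
  obtain ⟨C, hC⟩ := vs_bound p q h
  refine ⟨C + d, fun v hv a A hA hs => ?_⟩
  have : Nonempty (Fin d) := by
    by_contra hn
    rw [not_nonempty_iff] at hn
    exact hv (Subsingleton.elim v 0)
  have hex : ∀ x, ∃ i, x ∈ A → (ℝ ∙ v).mkQ x = (ℝ ∙ v).mkQ (a i) := by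
    intro x
    by_cases hx : x ∈ A
    · obtain ⟨i, t, e⟩ := hA x hx
      refine ⟨i, fun _ => ?_⟩
      rw [e, map_add, map_smul]
      have : (ℝ ∙ v).mkQ v = 0 := by simp
      rw [this, smul_zero, add_zero]
    · exact ⟨Classical.arbitrary _, fun h => absurd h hx⟩
  choose f hf using hex
  obtain ⟨g1, g2⟩ := geom d v hv a A f hf hs
  have := fiber_bound p q C (NeZero.ne p) (NeZero.ne q) (fun B => hC _ B)
    (ℝ ∙ v).mkQ.toAddMonoidHom (fun i => (ℝ ∙ v).mkQ (a i)) f A hf g1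
    (indep_inj p q (NeZero.ne p) (NeZero.ne q) hpq _ g2)
  simp only [Fintype.card_fin] at this
  rw [add_mul]
  nlinarith

theorem stmt6 (d : ℕ) (hd : 1 ≤ d) (q s : ℤ) (hco : IsCoprime q s) (hqs : 1 < q * s) :
    ∃ K : ℝ, ∀ (v : Fin d → ℝ), v ≠ 0 →
      ∀ (a : Fin d → (Fin d → ℝ)) (A : Finset (Fin d → ℝ)),
        (∀ x ∈ A, ∃ (i : Fin d) (t : ℝ), x = a i + t • v) →
        affineSpan ℝ (A : Set (Fin d → ℝ)) = ⊤ →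
        ((|q| : ℝ) + (|s| : ℝ) + 2 * d - 2) * A.card - K * d ≤
          (((A.image fun x => (q : ℝ) • x) + (A.image fun x => (s : ℝ) • x)).card : ℝ) := by
  have hq0 : q ≠ 0 := by rintro rfl; simp at hqs
  have hs0 : s ≠ 0 := by rintro rfl; simp at hqs
  have : NeZero q.natAbs := ⟨Int.natAbs_ne_zero.2 hq0⟩
  have : NeZero s.natAbs := ⟨Int.natAbs_ne_zero.2 hs0⟩
  have hc : q.natAbs.Coprime s.natAbs := Int.isCoprime_iff_gcd_eq_one.1 hco
  have hne : q.natAbs ≠ s.natAbs := by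
    intro he
    have h1 : s.natAbs = 1 := by
      rw [he] at hc
      simpa using hc
    have h2 : (q * s).natAbs = 1 := by rw [Int.natAbs_mul, he, h1]
    omega
  obtain ⟨K, hK⟩ := nat_main d q.natAbs s.natAbs hc hne
  refine ⟨K, fun v hv a A hA hs => ?_⟩
  have h1 := hK v hv a A hA hs
  have hcard : (DD q.natAbs s.natAbs A A).card ≤
      ((A.image fun x => (q : ℝ) • x) + (A.image fun x => (s : ℝ) • x)).card := by
    have hsign : ∃ e : ℤ, (q.natAbs : ℤ) = e * q ∧ (s.natAbs : ℤ) = e * s := by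
      rcases lt_or_gt_of_ne hq0 with h | h
      · have : s < 0 := by nlinarith
        exact ⟨-1, by omega, by omega⟩
      · have : 0 < s := by nlinarith
        exact ⟨1, by omega, by omega⟩
    obtain ⟨e, e1, e2⟩ := hsign
    have hsub : DD q.natAbs s.natAbs A A ⊆
        ((A.image fun x => (q : ℝ) • x) + (A.image fun x => (s : ℝ) • x)).image
          (fun z => (e : ℝ) • z) := by
      intro z hz
      obtain ⟨x, hx, y, hy, rfl⟩ := mem_DD.1 hz
      refine Finset.mem_image.2 ⟨(q : ℝ) • x + (s : ℝ) • y,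
        Finset.add_mem_add (Finset.mem_image_of_mem _ hx) (Finset.mem_image_of_mem _ hy), ?_⟩
      have e1' : ((q.natAbs : ℕ) : ℝ) = e * q := by
        rw [← Int.cast_natCast, e1, Int.cast_mul]
      have e2' : ((s.natAbs : ℕ) : ℝ) = e * s := by
        rw [← Int.cast_natCast, e2, Int.cast_mul]
      rw [← Nat.cast_smul_eq_nsmul ℝ, ← Nat.cast_smul_eq_nsmul ℝ, e1', e2', smul_add, smul_smul,
        smul_smul]
    exact (Finset.card_le_card hsub).trans Finset.card_image_le
  have h2 := h1.trans (Nat.add_le_add_right hcard _)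
  have hge : 2 ≤ q.natAbs + s.natAbs := by omega
  have h3 : (((q.natAbs + s.natAbs - 2) * A.card + 2 * d * A.card : ℕ) : ℝ) ≤ _ :=
    Nat.cast_le.2 h2
  push_cast [Nat.cast_sub hge] at h3
  have a1 : ((q.natAbs : ℕ) : ℝ) = |(q : ℝ)| := by rw [Nat.cast_natAbs]; push_cast; rfl
  have a2 : ((s.natAbs : ℕ) : ℝ) = |(s : ℝ)| := by rw [Nat.cast_natAbs]; push_cast; rfl
  rw [a1, a2] at h3
  linarith
end
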